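/- Let Y be a tail process with index α > 0 and finitely many exceedance-points (i.e. Y is a random element of ℝ₀^{ℤ^d} satisfying the tail-process identity, |Y_0| is Pareto(α)-distributed and independent of the spectral process Θ = Y/|Y_0|, and P(Θ ∈ l₀) = 1), set ϑ := E[1/|e(Y)|], let Q be any representative of the anchored spectral tail process, and let A = A^{fm} be the first-maximum anchoring function. Then for every measurable h : l₀ → [0,∞): E[h(θ_{A(Q)} Q)] = ϑ^{−1} E[ h(θ_{A(Θ)} Θ / ‖Θ‖) · ‖Θ‖^α / Σ_{k∈ℤ^d} |Θ_k|^α ]. -/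

import Mathlib

open MeasureTheory ENNReal Filter ProbabilityTheory

noncomputable section

/-- The space `ℝ^{ℤ^d}` of real-valued fields indexed by `ℤ^d`. -/
abbrev RField (d : ℕ) := (Fin d → ℤ) → ℝ

variable {d : ℕ}

/-- Shift operator: `shift k x = (x_{i+k})_i`, i.e. it moves the origin to `k`. -/
def shift (k : Fin d → ℤ) (x : RField d) : RField d := fun i => x (i + k)

/-- The set of exceedance-points of `x`. -/
def excSet (x : RField d) : Set (Fin d → ℤ) := {k | 1 < |x k|}

open Classical in
/-- Indicator (with values in `ℝ≥0∞`) of the event that `|x k| > s`. -/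
def exIndGT (s : ℝ) (k : Fin d → ℤ) (x : RField d) : ℝ≥0∞ := if s < |x k| then 1 else 0

/-- The tail-process identity:
`E[h(θ_k Y) 1{|Y_k| > 1}] = E[h(Y) 1{|Y_{−k}| > 1}]` for every measurable nonnegative `h`
and every `k ∈ ℤ^d`. -/
def TailIdentity {Ω : Type*} [MeasurableSpace Ω] (μ : Measure Ω) (Y : Ω → RField d) : Prop :=
  ∀ h : RField d → ℝ≥0∞, Measurable h → ∀ k : Fin d → ℤ,
    ∫⁻ ω, h (shift k (Y ω)) * exIndGT 1 k (Y ω) ∂μ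
      = ∫⁻ ω, h (Y ω) * exIndGT 1 (-k) (Y ω) ∂μ

/-- `Y` is exceedance-stationary: for every exceedance-map `τ` which is bijective on a
measurable set `B` (invariant under shifting the origin to exceedance-points, contained in
`ℝ₀^{ℤ^d}`) carrying the law of `Y`, we have `θ_τ Y ≐ Y`. -/
def ExcStationary {Ω : Type*} [MeasurableSpace Ω] (μ : Measure Ω) (Y : Ω → RField d) : Prop :=
  ∀ (B : Set (RField d)) (τ : RField d → Fin d → ℤ),
    MeasurableSet B → Measurable τ →
    (∀ x ∈ B, 1 < |x 0|) →
    (∀ x ∈ B, ∀ k ∈ excSet x, shift k x ∈ B) →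
    (∀ x ∈ B, τ x ∈ excSet x) →
    (∀ x ∈ B, Set.BijOn (fun k => k + τ (shift k x)) (excSet x) (excSet x)) →
    (∀ᵐ ω ∂μ, Y ω ∈ B) →
    Measure.map (fun ω => shift (τ (Y ω)) (Y ω)) μ = Measure.map Y μ

/-- `E₀`: elements of `ℝ₀^{ℤ^d}` with finitely many exceedance-points. -/
def E0set (d : ℕ) : Set (RField d) := {x | 1 < |x 0| ∧ (excSet x).Finite}

/-- `E`: elements of `ℝ^{ℤ^d}` with at least one but finitely many exceedance-points. -/
def Eset (d : ℕ) : Set (RField d) := {x | (excSet x).Nonempty ∧ (excSet x).Finite}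

/-- `l₀`: fields vanishing at infinity. -/
def l0set (d : ℕ) : Set (RField d) := {x | Tendsto (fun i => |x i|) cofinite (nhds 0)}

/-- Uniform norm `‖x‖ = sup_i |x_i|`. -/
def supNorm (x : RField d) : ℝ := ⨆ i, |x i|

/-- `V` is Pareto(α)-distributed: `P(V > y) = y^{-α}` for `y ≥ 1`. -/
def IsPareto {Ω : Type*} [MeasurableSpace Ω] (μ : Measure Ω) (V : Ω → ℝ) (α : ℝ) : Prop :=
  ∀ y : ℝ, 1 ≤ y → μ {ω | y < V ω} = ENNReal.ofReal (y ^ (-α))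

/-- An anchoring function on `S`: a measurable shift-covariant exceedance-map. -/
def IsAnchoringOn (S : Set (RField d)) (A : RField d → Fin d → ℤ) : Prop :=
  Measurable A ∧ ∀ x ∈ S, A x ∈ excSet x ∧ ∀ k ∈ excSet x, A (shift k x) + k = A x

/-- `h` is shift-invariant on `S`. -/
def ShiftInvariantOn (S : Set (RField d)) (h : RField d → ℝ≥0∞) : Prop :=
  ∀ x ∈ S, ∀ k : Fin d → ℤ, h (shift k x) = h x

/-- Data of a first-maximum anchoring function `A^{fm}`: a translation-invariant linear
(group) order `r` on `ℤ^d`, and a measurable map `Afm` which picks, for every nonzero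
`x ∈ l₀`, the `r`-smallest index at which `|x|` attains its maximum `‖x‖`. -/
structure FirstMaxData (d : ℕ) where
  r : (Fin d → ℤ) → (Fin d → ℤ) → Prop
  Afm : RField d → Fin d → ℤ
  r_linear : IsLinearOrder (Fin d → ℤ) r
  r_add_invariant : ∀ a b c : Fin d → ℤ, r a b → r (a + c) (b + c)
  meas : Measurable Afm
  mem_argmax : ∀ x ∈ l0set d, x ≠ 0 → |x (Afm x)| = supNorm x
  min_argmax : ∀ x ∈ l0set d, x ≠ 0 → ∀ k : Fin d → ℤ, |x k| = supNorm x → r (Afm x) k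

/-- `Q` (a random element of `l₀` on `(Ω₂, μ₂)`) is a representative of the anchored spectral
tail process of `Θ`: `E[h(Q)] = E[h(Θ) | A^{fm}(Θ) = 0]` for every shift-invariant
measurable `h : l₀ → [0,∞)`. -/
def IsSpectralRep {Ω : Type*} [MeasurableSpace Ω] (μ : Measure Ω) (Θ : Ω → RField d)
    (F : FirstMaxData d) {Ω₂ : Type*} [MeasurableSpace Ω₂] (μ₂ : Measure Ω₂)
    (Q : Ω₂ → RField d) : Prop :=
  ∀ h : RField d → ℝ≥0∞, Measurable h → ShiftInvariantOn (l0set d) h →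
    ∫⁻ ω, h (Q ω) ∂μ₂
      = ∫⁻ x, h x ∂(ProbabilityTheory.cond (Measure.map Θ μ) {x | F.Afm x = 0})

lemma measurable_shift (k : Fin d → ℤ) : Measurable (shift k : RField d → RField d) :=
  measurable_pi_lambda _ fun i => measurable_pi_apply (i + k)

lemma measurable_shift_comp {A : RField d → Fin d → ℤ} (hA : Measurable A) :
    Measurable fun x : RField d => shift (A x) x := by
  have huncurry : Measurable fun p : RField d × (Fin d → ℤ) => shift p.2 p.1 :=
    measurable_from_prod_countable_left fun k => measurable_shift k
  exact huncurry.comp (measurable_id.prodMk hA)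

lemma measurable_exIndGT (s : ℝ) (k : Fin d → ℤ) : Measurable (exIndGT s k) := by
  unfold exIndGT
  exact Measurable.ite (measurableSet_lt measurable_const (measurable_pi_apply k).abs)
    measurable_const measurable_const

lemma encard_excSet_eq_tsum (x : RField d) :
    ((excSet x).encard : ℝ≥0∞) = ∑' k, exIndGT 1 k x := by
  classical
  rw [← ENNReal.tsum_set_one, tsum_subtype (excSet x) fun _ => (1 : ℝ≥0∞)]
  refine tsum_congr fun k => ?_
  simp [exIndGT, excSet, Set.indicator_apply]

lemma bddAbove_abs_of_mem_l0set {x : RField d} (hx : x ∈ l0set d) :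
    BddAbove (Set.range fun i => |x i|) :=
  Filter.Tendsto.bddAbove_range_of_cofinite hx

lemma abs_le_supNorm {x : RField d} (hx : x ∈ l0set d) (k : Fin d → ℤ) : |x k| ≤ supNorm x :=
  le_ciSup (bddAbove_abs_of_mem_l0set hx) k

lemma excSet_finite {x : RField d} (hx : x ∈ l0set d) : (excSet x).Finite := by
  have h : ∀ᶠ i in cofinite, |x i| < 2⁻¹ := by
    exact Filter.Tendsto.eventually_lt_const (by norm_num) hx
  refine (Filter.eventually_cofinite.1 h).subset fun k hk => ?_
  have hk' : 1 < |x k| := hk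
  simp only [Set.mem_ofPred_eq, not_lt]
  linarith

lemma shift_mem_l0set {x : RField d} (hx : x ∈ l0set d) (k : Fin d → ℤ) :
    shift k x ∈ l0set d := by
  have h : Tendsto (fun i => |x i|) cofinite (nhds 0) := hx
  exact h.comp (add_left_injective k).tendsto_cofinite

lemma smul_mem_l0set {x : RField d} (hx : x ∈ l0set d) (c : ℝ) : c • x ∈ l0set d := by
  have h : Tendsto (fun i => |x i|) cofinite (nhds 0) := hx
  simpa [l0set, abs_mul] using h.const_mul |c|

lemma supNorm_shift (k : Fin d → ℤ) (x : RField d) : supNorm (shift k x) = supNorm x :=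
  (Equiv.addRight k).iSup_comp (g := fun i => |x i|)

lemma supNorm_smul {c : ℝ} (hc : 0 < c) (x : RField d) : supNorm (c • x) = c * supNorm x := by
  simp only [supNorm, Pi.smul_apply, smul_eq_mul, abs_mul, abs_of_pos hc]
  exact (Real.mul_iSup_of_nonneg hc.le _).symm

lemma shift_ne_zero {x : RField d} (hx : x ≠ 0) (k : Fin d → ℤ) : shift k x ≠ 0 := by
  intro h
  refine hx (funext fun i => ?_)
  simpa [shift] using congrFun h (i - k)

namespace FirstMaxData

variable (F : FirstMaxData d)

lemma Afm_eq {x : RField d} (hx : x ∈ l0set d) (h0 : x ≠ 0) {m : Fin d → ℤ}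
    (hm : |x m| = supNorm x) (hmin : ∀ k, |x k| = supNorm x → F.r m k) : F.Afm x = m := by
  have := F.r_linear
  exact antisymm_of F.r (F.min_argmax x hx h0 m hm) (hmin _ (F.mem_argmax x hx h0))

lemma Afm_shift {x : RField d} (hx : x ∈ l0set d) (h0 : x ≠ 0) (k : Fin d → ℤ) :
    F.Afm (shift k x) = F.Afm x - k := by
  refine F.Afm_eq (shift_mem_l0set hx k) (shift_ne_zero h0 k) ?_ fun j hj => ?_
  · simpa [shift, supNorm_shift] using F.mem_argmax x hx h0
  · rw [supNorm_shift] at hj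
    simpa [sub_eq_add_neg] using F.r_add_invariant _ _ (-k) (F.min_argmax x hx h0 (j + k) hj)

lemma Afm_smul {x : RField d} (hx : x ∈ l0set d) (h0 : x ≠ 0) {c : ℝ} (hc : 0 < c) :
    F.Afm (c • x) = F.Afm x := by
  refine F.Afm_eq (smul_mem_l0set hx c) (smul_ne_zero hc.ne' h0) ?_ fun j hj => ?_
  · simp [supNorm_smul hc, abs_mul, abs_of_pos hc, F.mem_argmax x hx h0]
  · refine F.min_argmax x hx h0 j ?_
    simpa [supNorm_smul hc, abs_mul, abs_of_pos hc, hc.ne'] using hj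

lemma shift_Afm_invariant {x : RField d} (hx : x ∈ l0set d) (k : Fin d → ℤ) :
    shift (F.Afm (shift k x)) (shift k x) = shift (F.Afm x) x := by
  by_cases h0 : x = 0
  · subst h0; rfl
  · rw [F.Afm_shift hx h0]
    funext i
    simp [shift, add_assoc]

lemma measurableSet_Afm_eq_zero : MeasurableSet {x | F.Afm x = 0} :=
  F.meas (measurableSet_singleton 0)

end FirstMaxData

/-- Mass transport: anchoring a tail process amounts to weighting the anchored configurations
by their number of exceedance-points. -/
lemma lintegral_shift_Afm {Ω : Type*} [MeasurableSpace Ω] {μ : Measure Ω} {Y : Ω → RField d}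
    (hY : Measurable Y) (hTI : TailIdentity μ Y)
    (hgood : ∀ᵐ ω ∂μ, 1 < |Y ω 0| ∧ Y ω ∈ l0set d) (F : FirstMaxData d)
    {H : RField d → ℝ≥0∞} (hH : Measurable H) :
    ∫⁻ ω, H (shift (F.Afm (Y ω)) (Y ω)) ∂μ
      = ∑' k, ∫⁻ ω, {x | F.Afm x = 0}.indicator H (Y ω) * exIndGT 1 k (Y ω) ∂μ := by
  set f := {x | F.Afm x = 0}.indicator H
  have hfm : Measurable f := hH.indicator F.measurableSet_Afm_eq_zero
  have hsum : ∀ᵐ ω ∂μ, H (shift (F.Afm (Y ω)) (Y ω))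
      = ∑' k, f (shift k (Y ω)) * exIndGT 1 k (Y ω) := by
    filter_upwards [hgood] with ω ⟨h1, hl⟩
    have h0 : Y ω ≠ 0 := by
      intro h
      rw [h] at h1
      norm_num at h1
    have hmax : 1 < |Y ω (F.Afm (Y ω))| := by
      rw [F.mem_argmax _ hl h0]
      exact h1.trans_le (abs_le_supNorm hl 0)
    rw [tsum_eq_single (F.Afm (Y ω)) fun k hk => ?_]
    · simp [f, F.Afm_shift hl h0, exIndGT, hmax]
    · simp [f, F.Afm_shift hl h0, sub_eq_zero, hk.symm]
  calc ∫⁻ ω, H (shift (F.Afm (Y ω)) (Y ω)) ∂μ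
      = ∑' k, ∫⁻ ω, f (shift k (Y ω)) * exIndGT 1 k (Y ω) ∂μ := by
        rw [lintegral_congr_ae hsum, lintegral_tsum fun k => ?_]
        exact (((hfm.comp (measurable_shift k)).comp hY).mul
          ((measurable_exIndGT 1 k).comp hY)).aemeasurable
    _ = ∑' k, ∫⁻ ω, f (Y ω) * exIndGT 1 (-k) (Y ω) ∂μ := tsum_congr fun k => hTI f hfm k
    _ = _ := (Equiv.neg (Fin d → ℤ)).tsum_eq
        fun k => ∫⁻ ω, f (Y ω) * exIndGT 1 k (Y ω) ∂μ

lemma lintegral_indepFun_eq {Ω E G : Type*} [MeasurableSpace Ω] [MeasurableSpace E]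
    [MeasurableSpace G] {μ : Measure Ω} [IsProbabilityMeasure μ] {V : Ω → E} {Z : Ω → G}
    (hV : Measurable V) (hZ : Measurable Z) (hind : IndepFun V Z μ)
    {f : E × G → ℝ≥0∞} (hf : Measurable f) :
    ∫⁻ ω, f (V ω, Z ω) ∂μ = ∫⁻ ω, ∫⁻ ω', f (V ω', Z ω) ∂μ ∂μ := by
  have hprod := (indepFun_iff_map_prod_eq_prod_map_map hV.aemeasurable hZ.aemeasurable).1 hind
  have : IsProbabilityMeasure (μ.map V) := Measure.isProbabilityMeasure_map hV.aemeasurable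
  have : IsProbabilityMeasure (μ.map Z) := Measure.isProbabilityMeasure_map hZ.aemeasurable
  rw [← lintegral_map hf (hV.prodMk hZ), hprod, lintegral_prod_symm _ hf.aemeasurable,
    lintegral_map hf.lintegral_prod_left' hZ]
  exact lintegral_congr fun ω => lintegral_map (hf.comp measurable_prodMk_right) hV

lemma IsPareto.measure_one_lt_mul {Ω : Type*} [MeasurableSpace Ω] {μ : Measure Ω} {V : Ω → ℝ}
    {α : ℝ} (hV : IsPareto μ V α) (hα : 0 < α) {a : ℝ} (ha : 0 ≤ a) (ha1 : a ≤ 1) :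
    μ {ω | 1 < V ω * a} = ENNReal.ofReal (a ^ α) := by
  rcases ha.eq_or_lt with rfl | hpos
  · have hempty : {ω | 1 < V ω * 0} = ∅ := by
      ext ω
      simp only [mul_zero, Set.mem_ofPred_eq, Set.mem_empty_iff_false, iff_false]
      norm_num
    rw [hempty, Real.zero_rpow hα.ne']
    simp
  · have hset : {ω | 1 < V ω * a} = {ω | a⁻¹ < V ω} := by
      ext ω
      exact (inv_lt_iff_one_lt_mul₀ hpos).symm
    rw [hset, hV _ ((one_le_inv₀ hpos).2 ha1), Real.inv_rpow ha, Real.rpow_neg ha, inv_inv]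

lemma IsPareto.lintegral_mul_exIndGT {Ω : Type*} [MeasurableSpace Ω] {μ : Measure Ω}
    [IsProbabilityMeasure μ] {Y Θ : Ω → RField d} {V : Ω → ℝ} {α : ℝ} (hPar : IsPareto μ V α)
    (hα : 0 < α) (hV : Measurable V) (hΘ : Measurable Θ) (hind : IndepFun V Θ μ)
    {k : Fin d → ℤ} (hYΘ : ∀ᵐ ω ∂μ, |Y ω k| = V ω * |Θ ω k|)
    {f : RField d → ℝ≥0∞} (hf : Measurable f) (hle : ∀ᵐ ω ∂μ, f (Θ ω) ≠ 0 → |Θ ω k| ≤ 1) :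
    ∫⁻ ω, f (Θ ω) * exIndGT 1 k (Y ω) ∂μ
      = ∫⁻ ω, f (Θ ω) * ENNReal.ofReal (|Θ ω k| ^ α) ∂μ := by
  classical
  let S : Set (ℝ × RField d) := {p | 1 < p.1 * |p.2 k|}
  have hS : MeasurableSet S := measurableSet_lt measurable_const
    (measurable_fst.mul ((measurable_pi_apply k).comp measurable_snd).abs)
  have hY : ∫⁻ ω, f (Θ ω) * exIndGT 1 k (Y ω) ∂μ
      = ∫⁻ ω, f (Θ ω) * S.indicator 1 (V ω, Θ ω) ∂μ := by
    refine lintegral_congr_ae ?_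
    filter_upwards [hYΘ] with ω h
    simp [exIndGT, S, Set.indicator_apply, h]
  rw [hY, lintegral_indepFun_eq (f := fun p => f p.2 * S.indicator 1 p) hV hΘ hind
    ((hf.comp measurable_snd).mul (measurable_one.indicator hS))]
  refine lintegral_congr_ae ?_
  filter_upwards [hle] with ω h
  have hmeas : MeasurableSet {ω' | 1 < V ω' * |Θ ω k|} :=
    measurableSet_lt measurable_const (hV.mul_const _)
  have hind' : (fun ω' => S.indicator (1 : ℝ × RField d → ℝ≥0∞) (V ω', Θ ω))
      = {ω' | 1 < V ω' * |Θ ω k|}.indicator 1 := by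
    funext ω'
    simp [S, Set.indicator_apply]
  by_cases h0 : f (Θ ω) = 0
  · simp [h0]
  · rw [lintegral_const_mul _ (by rw [hind']; exact measurable_one.indicator hmeas), hind',
      lintegral_indicator_one hmeas, hPar.measure_one_lt_mul hα (abs_nonneg _) (h h0)]

lemma tsum_abs_rpow_shift_smul (x : RField d) {c α : ℝ} (hc : 0 < c) (k : Fin d → ℤ) :
    ∑' i, ENNReal.ofReal (|(c⁻¹ • shift k x) i| ^ α)
      = (∑' i, ENNReal.ofReal (|x i| ^ α)) / ENNReal.ofReal (c ^ α) := by
  rw [← (Equiv.addRight k).tsum_eq fun i => ENNReal.ofReal (|x i| ^ α), div_eq_mul_inv,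
    ← ENNReal.tsum_mul_right]
  refine tsum_congr fun i => ?_
  simp only [Pi.smul_apply, smul_eq_mul, shift, abs_mul, abs_inv, abs_of_pos hc,
    Equiv.coe_addRight]
  rw [Real.mul_rpow (inv_nonneg.2 hc.le) (abs_nonneg _), Real.inv_rpow hc.le,
    ENNReal.ofReal_mul (inv_nonneg.2 (Real.rpow_nonneg hc.le _)),
    ENNReal.ofReal_inv_of_pos (Real.rpow_pos_of_pos hc _), mul_comm]

/-- With `Y`, `Θ`, `ϑ`, `Q` as in the spectral Palm duality and
`A = A^{fm}` the first-maximum anchoring function, for all measurable `h ≥ 0`: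
`E[h(θ_{A(Q)} Q)] = ϑ⁻¹ E[h(θ_{A(Θ)} Θ / ‖Θ‖) ‖Θ‖^α / Σ_k |Θ_k|^α]`. -/
theorem spectral_palm_inversion_dual
    {Ω : Type*} [MeasurableSpace Ω] (μ : Measure Ω) [IsProbabilityMeasure μ]
    {Ω₂ : Type*} [MeasurableSpace Ω₂] (μ₂ : Measure Ω₂) [IsProbabilityMeasure μ₂]
    (Y : Ω → RField d) (hY : Measurable Y) (hTI : TailIdentity μ Y)
    (α : ℝ) (hα : 0 < α) (hPar : IsPareto μ (fun ω => |Y ω 0|) α)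
    (Θ : Ω → RField d) (hΘdef : Θ = fun ω => fun i => Y ω i / |Y ω 0|)
    (hind : IndepFun (fun ω => |Y ω 0|) Θ μ)
    (hl0 : ∀ᵐ ω ∂μ, Θ ω ∈ l0set d)
    (ϑ : ℝ≥0∞) (hϑ : ϑ = ∫⁻ ω, ((excSet (Y ω)).encard)⁻¹ ∂μ)
    (F : FirstMaxData d)
    (Q : Ω₂ → RField d) (hQ : Measurable Q) (hQl0 : ∀ᵐ ω ∂μ₂, Q ω ∈ l0set d)
    (hrep : IsSpectralRep μ Θ F μ₂ Q) :
    ∀ h : RField d → ℝ≥0∞, Measurable h →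
      ∫⁻ ω, h (shift (F.Afm (Q ω)) (Q ω)) ∂μ₂
        = ϑ⁻¹ *
            ∫⁻ ω, h ((supNorm (Θ ω))⁻¹ • shift (F.Afm (Θ ω)) (Θ ω)) *
              (ENNReal.ofReal (supNorm (Θ ω) ^ α) /
                ∑' k : Fin d → ℤ, ENNReal.ofReal (|Θ ω k| ^ α)) ∂μ := by
  intro h hh
  have hV : Measurable fun ω => |Y ω 0| := ((measurable_pi_apply 0).comp hY).abs
  have hΘ : Measurable Θ := by
    rw [hΘdef]
    exact measurable_pi_lambda _ fun i => ((measurable_pi_apply i).comp hY).div hV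
  have hVgt : ∀ᵐ ω ∂μ, 1 < |Y ω 0| := by
    refine (mem_ae_iff_prob_eq_one (measurableSet_lt measurable_const hV)).2 ?_
    simpa using hPar 1 le_rfl
  have hYΘ : ∀ᵐ ω ∂μ, Y ω = |Y ω 0| • Θ ω := by
    filter_upwards [hVgt] with ω h1
    funext i
    simp only [hΘdef, Pi.smul_apply, smul_eq_mul]
    field_simp
  have hgood : ∀ᵐ ω ∂μ, 1 < |Y ω 0| ∧ Y ω ∈ l0set d := by
    filter_upwards [hVgt, hYΘ, hl0] with ω h1 hs hl
    exact ⟨h1, hs ▸ smul_mem_l0set hl _⟩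
  have hΘ0 : ∀ᵐ ω ∂μ, |Θ ω 0| = 1 := by
    filter_upwards [hVgt] with ω h1
    simp only [hΘdef, abs_div, abs_abs]
    exact div_self (by linarith)
  have hΘne : ∀ᵐ ω ∂μ, Θ ω ≠ 0 := by
    filter_upwards [hΘ0] with ω h1 h0
    simp [h0] at h1
  have hAfm : ∀ᵐ ω ∂μ, F.Afm (Y ω) = F.Afm (Θ ω) := by
    filter_upwards [hVgt, hYΘ, hl0, hΘne] with ω h1 hs hl h0
    conv_lhs => rw [hs]
    exact F.Afm_smul hl h0 (by linarith)
  have hnorm : ∀ᵐ ω ∂μ, 0 < supNorm (Θ ω) := by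
    filter_upwards [hΘ0, hl0] with ω h1 hl
    exact zero_lt_one.trans_le (h1 ▸ abs_le_supNorm hl 0)
  let S : RField d → ℝ≥0∞ := fun x => ∑' k, ENNReal.ofReal (|x k| ^ α)
  have hS : Measurable S := Measurable.tsum fun k =>
    ((measurable_pi_apply k).abs.pow_const α).ennreal_ofReal
  have hZ := F.measurableSet_Afm_eq_zero
  have hϑZ : ϑ = μ.map Θ {x | F.Afm x = 0} := by
    let H : RField d → ℝ≥0∞ := fun x => (∑' k, exIndGT 1 k x)⁻¹
    have hH : Measurable H :=
      (Measurable.tsum fun k => measurable_exIndGT 1 k).inv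
    have hHshift : ∀ k x, H (shift k x) = H x := fun k x =>
      congrArg (·⁻¹) ((Equiv.addRight k).tsum_eq fun i => exIndGT 1 i x)
    have htransport := lintegral_shift_Afm hY hTI hgood F hH
    have hmeas : ∀ k, AEMeasurable
        (fun ω => {x | F.Afm x = 0}.indicator H (Y ω) * exIndGT 1 k (Y ω)) μ := fun k =>
      (((hH.indicator hZ).comp hY).mul ((measurable_exIndGT 1 k).comp hY)).aemeasurable
    rw [← lintegral_tsum hmeas] at htransport
    simp only [hHshift, ENNReal.tsum_mul_left] at htransport
    simp only [hϑ, encard_excSet_eq_tsum]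
    refine htransport.trans ?_
    rw [← lintegral_indicator_one hZ, lintegral_map (measurable_one.indicator hZ) hΘ]
    refine lintegral_congr_ae ?_
    filter_upwards [hgood, hAfm] with ω ⟨h1, hl⟩ hA
    by_cases h0 : F.Afm (Θ ω) = 0
    · simp only [Set.indicator_apply, Set.mem_ofPred_eq, hA, h0, if_true, H, Pi.one_apply]
      rw [← encard_excSet_eq_tsum]
      refine ENNReal.inv_mul_cancel ?_ ?_
      · have hne : (excSet (Y ω)).Nonempty := ⟨0, h1⟩
        simpa using hne.ne_empty
      · simpa using excSet_finite hl
    · simp [hA, h0]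
  have hspectral : ∀ g : RField d → ℝ≥0∞, Measurable g →
      ∫⁻ ω, g ((supNorm (Θ ω))⁻¹ • shift (F.Afm (Θ ω)) (Θ ω)) ∂μ
        = ∫⁻ ω, {x | F.Afm x = 0}.indicator g (Θ ω) * S (Θ ω) ∂μ := by
    intro g hg
    let N : RField d → RField d := fun x => |x 0|⁻¹ • x
    have hN : Measurable N := (measurable_pi_apply 0).abs.inv.smul measurable_id
    have hgZ := hg.indicator hZ
    calc ∫⁻ ω, g ((supNorm (Θ ω))⁻¹ • shift (F.Afm (Θ ω)) (Θ ω)) ∂μ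
        = ∫⁻ ω, g (N (shift (F.Afm (Y ω)) (Y ω))) ∂μ := by
          refine lintegral_congr_ae ?_
          filter_upwards [hVgt, hYΘ, hl0, hΘne, hAfm] with ω h1 hs hl h0 hA
          have hVpos : 0 < |Y ω 0| := by linarith
          have hY' : ∀ i, Y ω i = |Y ω 0| * Θ ω i := fun i => congrFun hs i
          have hA' := F.mem_argmax _ hl h0
          congr 1
          funext i
          simp only [N, hA, shift, Pi.smul_apply, smul_eq_mul, zero_add]
          rw [hY' (F.Afm (Θ ω)), hY' (i + F.Afm (Θ ω)), abs_mul, abs_abs, hA']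
          field_simp
      _ = ∑' k, ∫⁻ ω, {x | F.Afm x = 0}.indicator (g ∘ N) (Y ω) * exIndGT 1 k (Y ω) ∂μ :=
          lintegral_shift_Afm hY hTI hgood F (hg.comp hN)
      _ = ∑' k, ∫⁻ ω, {x | F.Afm x = 0}.indicator g (Θ ω) * exIndGT 1 k (Y ω) ∂μ := by
          refine tsum_congr fun k => lintegral_congr_ae ?_
          filter_upwards [hAfm] with ω hA
          have hNY : N (Y ω) = Θ ω := by
            funext i
            simp only [N, hΘdef, Pi.smul_apply, smul_eq_mul]
            rw [div_eq_inv_mul]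
          simp [Set.indicator_apply, hA, hNY]
      _ = ∑' k, ∫⁻ ω, {x | F.Afm x = 0}.indicator g (Θ ω)
            * ENNReal.ofReal (|Θ ω k| ^ α) ∂μ := by
          refine tsum_congr fun k => hPar.lintegral_mul_exIndGT hα hV hΘ hind ?_ hgZ ?_
          · filter_upwards [hYΘ] with ω hs
            conv_lhs => rw [hs]
            simp [abs_mul]
          · filter_upwards [hl0, hΘne, hΘ0] with ω hl h0 h1 hne
            have hA : Θ ω ∈ {x | F.Afm x = 0} := Set.mem_of_indicator_ne_zero hne
            have hmax := F.mem_argmax _ hl h0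
            rw [show F.Afm (Θ ω) = 0 from hA, h1] at hmax
            exact hmax ▸ abs_le_supNorm hl k
      _ = _ := by
          have hmeas : ∀ k, AEMeasurable (fun ω => {x | F.Afm x = 0}.indicator g (Θ ω)
              * ENNReal.ofReal (|Θ ω k| ^ α)) μ := fun k => ((hgZ.comp hΘ).mul
            (((measurable_pi_apply k).comp hΘ).abs.pow_const α).ennreal_ofReal).aemeasurable
          rw [← lintegral_tsum hmeas]
          simp only [ENNReal.tsum_mul_left, S]
  have hSfin : ∀ᵐ ω ∂μ, F.Afm (Θ ω) = 0 → S (Θ ω) ≠ ∞ := by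
    have hone := hspectral 1 measurable_one
    have hfin : ∫⁻ ω, {x | F.Afm x = 0}.indicator 1 (Θ ω) * S (Θ ω) ∂μ ≠ ∞ := by
      rw [← hone]
      simp
    filter_upwards [ae_lt_top (((measurable_one.indicator hZ).comp hΘ).mul (hS.comp hΘ)) hfin]
      with ω hlt h0
    simpa [Set.indicator_apply, h0] using hlt.ne
  have hinv : Measurable fun x => h (shift (F.Afm x) x) := hh.comp (measurable_shift_comp F.meas)
  rw [hrep (fun x => h (shift (F.Afm x) x)) hinv
    fun x hx k => congrArg h (F.shift_Afm_invariant hx k), ProbabilityTheory.cond,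
    lintegral_smul_measure, ← hϑZ, smul_eq_mul]
  congr 1
  calc ∫⁻ x in {x | F.Afm x = 0}, h (shift (F.Afm x) x) ∂(μ.map Θ)
      = ∫⁻ ω, {x | F.Afm x = 0}.indicator (fun x => h x / S x) (Θ ω) * S (Θ ω) ∂μ := by
        rw [← lintegral_indicator hZ, lintegral_map (hinv.indicator hZ) hΘ]
        refine lintegral_congr_ae ?_
        filter_upwards [hSfin, hΘ0] with ω hfin h1
        by_cases h0 : F.Afm (Θ ω) = 0
        · have hpos : S (Θ ω) ≠ 0 := by
            intro hz
            have := ENNReal.tsum_eq_zero.1 hz 0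
            simp [h1] at this
          have hsh : shift 0 (Θ ω) = Θ ω := by
            funext i
            simp [shift]
          simp [h0, hsh, ENNReal.div_mul_cancel hpos (hfin h0)]
        · simp [h0]
    _ = ∫⁻ ω, h ((supNorm (Θ ω))⁻¹ • shift (F.Afm (Θ ω)) (Θ ω))
          / S ((supNorm (Θ ω))⁻¹ • shift (F.Afm (Θ ω)) (Θ ω)) ∂μ :=
        (hspectral _ (hh.div hS)).symm
    _ = _ := by
        refine lintegral_congr_ae ?_
        filter_upwards [hnorm] with ω hpos
        have hc : ENNReal.ofReal (supNorm (Θ ω) ^ α) ≠ 0 := by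
          simpa using Real.rpow_pos_of_pos hpos α
        simp only [S, tsum_abs_rpow_shift_smul _ hpos]
        rw [div_eq_mul_inv, ENNReal.inv_div (Or.inl ENNReal.ofReal_ne_top) (Or.inl hc)]
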